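/- For any nonempty subset I of {1,…,n} and any nonnegative integer m, P( C_I(σ) = m ) ≤ (e^{H_n − H(I)} / n) · ( H(I)^m / m! ) · ( 1_{I ≠ {1,…,n}} + m / H(I) ), where 1_{I ≠ {1,…,n}} equals 1 if I is a proper subset of {1,…,n} and 0 otherwise. In particular, P( C_I(σ) = 0 ) ≤ e^{H_n − H(I)} / n. -/

import Mathlib

open Finset

/-- The number of cycles of length `j` in the permutation `σ` of `{1,…,n}`
(fixed points count as cycles of length 1): the number of points whose
orbit under `σ` has size `j`, divided by `j`. -/
noncomputable def cycleCount {n : ℕ} (σ : Equiv.Perm (Fin n)) (j : ℕ) : ℕ :=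
  (Finset.univ.filter fun x => Function.minimalPeriod (⇑σ) x = j).card / j

/-- The number of cycles of `σ` whose length lies in the set `I`. -/
noncomputable def cycleCountIn {n : ℕ} (σ : Equiv.Perm (Fin n)) (I : Finset ℕ) : ℕ :=
  ∑ j ∈ I, cycleCount σ j

/-- The total number of cycles of `σ` (fixed points included as 1-cycles). -/
noncomputable def totalCycles {n : ℕ} (σ : Equiv.Perm (Fin n)) : ℕ :=
  cycleCountIn σ (Finset.Icc 1 n)

/-- Probability of an event under a uniformly random permutation of `{1,…,n}`. -/
noncomputable def permP (n : ℕ) (E : Equiv.Perm (Fin n) → Prop) : ℝ :=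
  (Nat.card {σ : Equiv.Perm (Fin n) // E σ} : ℝ) / n.factorial

/-- Expectation of `f` under a uniformly random permutation of `{1,…,n}`. -/
noncomputable def permE (n : ℕ) (f : Equiv.Perm (Fin n) → ℝ) : ℝ :=
  (∑ σ : Equiv.Perm (Fin n), f σ) / n.factorial

/-- `H(I) = ∑_{j ∈ I} 1/j`. -/
noncomputable def Hset (I : Finset ℕ) : ℝ := ∑ j ∈ I, (1 : ℝ) / j

/-- The harmonic sum `H_n = ∑_{i=1}^n 1/i`. -/
noncomputable def harm (n : ℕ) : ℝ := Hset (Finset.Icc 1 n)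

lemma minPer_eq {n : ℕ} (σ : Equiv.Perm (Fin n)) (x : Fin n) (hx : x ∈ σ.support) :
    Function.minimalPeriod (⇑σ) x = (σ.cycleOf x).support.card := by
  have hc := Equiv.Perm.isCycleOn_support_cycleOf σ x
  have hx' : x ∈ (σ.cycleOf x).support := by
    rw [Equiv.Perm.mem_support_cycleOf_iff]
    exact ⟨Equiv.Perm.SameCycle.refl _ _, hx⟩
  have key : ∀ k : ℕ, Function.minimalPeriod (⇑σ) x ∣ k ↔ (σ.cycleOf x).support.card ∣ k := by
    intro k
    rw [← Function.isPeriodicPt_iff_minimalPeriod_dvd, ← hc.pow_apply_eq hx',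
      Function.IsPeriodicPt, Function.IsFixedPt, Equiv.Perm.iterate_eq_pow]
  exact Nat.dvd_antisymm ((key _).2 dvd_rfl) ((key _).1 dvd_rfl)

lemma cycleCount_of_two_le {n : ℕ} (σ : Equiv.Perm (Fin n)) (j : ℕ) (hj : 2 ≤ j) :
    cycleCount σ j = σ.cycleType.count j := by
  have h1 : (Finset.univ.filter fun x => Function.minimalPeriod (⇑σ) x = j) =
      (σ.cycleFactorsFinset.filter fun c => c.support.card = j).biUnion
        (fun c => c.support) := by
    ext x
    simp only [mem_filter, mem_univ, true_and, mem_biUnion]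
    constructor
    · intro h
      have hx : x ∈ σ.support := by
        rw [Equiv.Perm.mem_support]
        intro hfix
        have := (Function.minimalPeriod_eq_one_iff_isFixedPt (f := ⇑σ) (x := x)).2 hfix
        omega
      refine ⟨σ.cycleOf x, ⟨Equiv.Perm.cycleOf_mem_cycleFactorsFinset_iff.2 hx, ?_⟩, ?_⟩
      · rw [← minPer_eq σ x hx, h]
      · rw [Equiv.Perm.mem_support_cycleOf_iff]
        exact ⟨Equiv.Perm.SameCycle.refl _ _, hx⟩
    · rintro ⟨c, ⟨hc, hcard⟩, hxc⟩
      have hcx := Equiv.Perm.cycle_is_cycleOf hxc hc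
      have hx : x ∈ σ.support := Equiv.Perm.mem_cycleFactorsFinset_support_le hc hxc
      rw [minPer_eq σ x hx, ← hcx, hcard]
  have h2 : (Finset.univ.filter fun x => Function.minimalPeriod (⇑σ) x = j).card =
      σ.cycleType.count j * j := by
    rw [h1, card_biUnion]
    · rw [sum_congr rfl (g := fun _ => j) (fun c hc => (mem_filter.1 hc).2), sum_const,
        Equiv.Perm.CycleType.count_def, smul_eq_mul]
      congr 1
      rw [Fintype.card_subtype, ← card_map (Function.Embedding.subtype _)]
      congr 1
      ext c
      simp [and_comm]
    · intro c hc d hd hcd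
      have := Equiv.Perm.cycleFactorsFinset_pairwise_disjoint σ (mem_filter.1 hc).1
        (mem_filter.1 hd).1 hcd
      exact this.disjoint_support
  rw [cycleCount, h2, Nat.mul_div_cancel _ (by omega)]

lemma cycleCount_one {n : ℕ} (σ : Equiv.Perm (Fin n)) :
    cycleCount σ 1 = n - σ.cycleType.sum := by
  rw [cycleCount, Nat.div_one, Equiv.Perm.sum_cycleType]
  have : (Finset.univ.filter fun x => Function.minimalPeriod (⇑σ) x = 1) = σ.supportᶜ := by
    ext x
    simp [Function.minimalPeriod_eq_one_iff_isFixedPt, Function.IsFixedPt]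
  rw [this, card_compl, Fintype.card_fin]

lemma cycleCount_ne_zero {n : ℕ} (σ : Equiv.Perm (Fin n)) (j : ℕ) (h : cycleCount σ j ≠ 0) :
    j ∈ Icc 1 n := by
  rw [mem_Icc]
  constructor
  · by_contra hj
    have : j = 0 := by omega
    subst this
    simp [cycleCount] at h
  · by_contra hj
    apply h
    rw [cycleCount]
    apply Nat.div_eq_of_lt
    refine lt_of_le_of_lt (card_le_univ _) ?_
    simpa using hj

lemma toFinset_sub {n : ℕ} (σ : Equiv.Perm (Fin n)) : σ.cycleType.toFinset ⊆ Icc 2 n := by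
  intro a ha
  rw [Multiset.mem_toFinset] at ha
  rw [mem_Icc]
  refine ⟨Equiv.Perm.two_le_of_mem_cycleType ha, ?_⟩
  have := Multiset.le_sum_of_mem ha
  have h2 := σ.sum_cycleType_le
  rw [Fintype.card_fin] at h2
  omega

lemma Icc_eq_insert (n : ℕ) (hn : 1 ≤ n) : Icc 1 n = insert 1 (Icc 2 n) := by
  ext a; simp only [mem_Icc, mem_insert]; omega

lemma sum_cycleCount {n : ℕ} (hn : 1 ≤ n) (σ : Equiv.Perm (Fin n)) :
    ∑ j ∈ Icc 1 n, j * cycleCount σ j = n := by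
  rw [Icc_eq_insert n hn, sum_insert (by simp), cycleCount_one]
  have h2 := σ.sum_cycleType_le
  rw [Fintype.card_fin] at h2
  have : ∑ j ∈ Icc 2 n, j * cycleCount σ j = σ.cycleType.sum := by
    rw [Finset.sum_multiset_count_of_subset _ _ (toFinset_sub σ)]
    refine sum_congr rfl fun j hj => ?_
    rw [cycleCount_of_two_le σ j (mem_Icc.1 hj).1, smul_eq_mul, mul_comm]
  rw [this]; omega

/-- The Poisson-type weight of a vector of cycle counts. -/
noncomputable def wt (s : Finset ℕ) (c : ℕ → ℕ) : ℝ :=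
  ∏ j ∈ s, ((1 : ℝ) / j) ^ c j / (c j).factorial

lemma wt_nonneg (s : Finset ℕ) (c : ℕ → ℕ) : 0 ≤ wt s c :=
  prod_nonneg fun j _ => by positivity

lemma card_fiber_le {n : ℕ} (hn : 1 ≤ n) (τ : Equiv.Perm (Fin n))
    (A : Finset (Equiv.Perm (Fin n))) (hA : ∀ σ ∈ A, cycleCount σ = cycleCount τ) :
    (A.card : ℝ) ≤
      n.factorial * wt (Icc 1 n) (cycleCount τ) := by
  have hsub : A ⊆
      (Finset.univ : Finset (Equiv.Perm (Fin n))).filter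
        fun σ => σ.cycleType = τ.cycleType := by
    intro σ hσ
    replace hσ := hA σ hσ
    simp only [mem_filter, mem_univ, true_and]
    ext j
    by_cases hj : 2 ≤ j
    · rw [← cycleCount_of_two_le σ j hj, ← cycleCount_of_two_le τ j hj, hσ]
    · rw [Multiset.count_eq_zero_of_notMem, Multiset.count_eq_zero_of_notMem]
      · exact fun h => hj (Equiv.Perm.two_le_of_mem_cycleType h)
      · exact fun h => hj (Equiv.Perm.two_le_of_mem_cycleType h)
  refine (Nat.cast_le.2 (card_le_card hsub)).trans ?_
  rw [Equiv.Perm.card_of_cycleType, if_pos ⟨τ.sum_cycleType_le,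
    fun a ha => Equiv.Perm.two_le_of_mem_cycleType ha⟩, Fintype.card_fin, ← cycleCount_one]
  refine Nat.cast_div_le.trans (le_of_eq ?_)
  rw [div_eq_mul_inv]
  congr 1
  rw [wt, Icc_eq_insert n hn, prod_insert (by simp)]
  have e1 : τ.cycleType.prod = ∏ j ∈ Icc 2 n, j ^ cycleCount τ j := by
    rw [Finset.prod_multiset_count_of_subset _ _ (toFinset_sub τ)]
    refine prod_congr rfl fun j hj => ?_
    rw [cycleCount_of_two_le τ j (mem_Icc.1 hj).1]
  have e2 : ∏ j ∈ τ.cycleType.toFinset, (τ.cycleType.count j).factorial =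
      ∏ j ∈ Icc 2 n, (cycleCount τ j).factorial := by
    rw [← prod_subset (toFinset_sub τ)]
    · refine prod_congr rfl fun j hj => ?_
      rw [cycleCount_of_two_le τ j (mem_Icc.1 (toFinset_sub τ hj)).1]
    · intro j hj hj'
      rw [cycleCount_of_two_le τ j (mem_Icc.1 hj).1, Multiset.count_eq_zero_of_notMem]
      · rfl
      · simpa using hj'
  rw [e1, e2]
  push_cast
  rw [mul_assoc, ← prod_mul_distrib, mul_inv, ← prod_inv_distrib]
  congr 1
  · simp
  · refine prod_congr rfl fun j hj => ?_
    rw [one_div, inv_pow, mul_inv, div_eq_mul_inv]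

lemma sum_wt_piAntidiag (s : Finset ℕ) (m : ℕ) :
    ∑ c ∈ piAntidiag s m, wt s c = Hset s ^ m / m.factorial := by
  rw [Hset, sum_pow_eq_sum_piAntidiag, sum_div]
  refine sum_congr rfl fun c hc => ?_
  have hs : ∑ i ∈ s, c i = m := (mem_piAntidiag.1 hc).1
  have h := Nat.multinomial_spec s c
  rw [hs] at h
  have h' : (∏ i ∈ s, ((c i).factorial : ℝ)) * (Nat.multinomial s c : ℝ) = m.factorial := by
    exact_mod_cast h
  have hp : (∏ i ∈ s, ((c i).factorial : ℝ)) ≠ 0 :=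
    prod_ne_zero_iff.2 fun i _ => by positivity
  have hm : (m.factorial : ℝ) ≠ 0 := by positivity
  rw [wt, prod_div_distrib, div_eq_div_iff hp hm, ← h']
  ring

/-- Restriction of a vector to a set of indices. -/
def restr (s : Finset ℕ) (c : ℕ → ℕ) : ℕ → ℕ := fun j => if j ∈ s then c j else 0

lemma Hset_nonneg (s : Finset ℕ) : 0 ≤ Hset s := sum_nonneg fun j _ => by positivity

lemma sum_wt_le (N I : Finset ℕ) (hI : I ⊆ N) (m : ℕ) (T : Finset (ℕ → ℕ))
    (hsupp : ∀ c ∈ T, ∀ j, c j ≠ 0 → j ∈ N) (hm : ∀ c ∈ T, ∑ j ∈ I, c j = m) :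
    ∑ c ∈ T, wt N c ≤ Real.exp (Hset N - Hset I) * (Hset I ^ m / m.factorial) := by
  classical
  set J := N \ I with hJ
  have hH : Hset N - Hset I = Hset J := by
    rw [Hset, Hset, Hset, hJ, ← sum_sdiff hI]; ring
  rw [hH]
  set L := T.sup (fun c => ∑ j ∈ J, c j) with hL
  have hbU : ∑ d ∈ (range (L + 1)).biUnion (fun l => piAntidiag J l), wt J d ≤
      Real.exp (Hset J) := by
    rw [sum_biUnion]
    · rw [sum_congr rfl fun l _ => sum_wt_piAntidiag J l]
      exact Real.sum_le_exp_of_nonneg (Hset_nonneg J) _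
    · intro a _ b _ hab
      rw [Function.onFun, Finset.disjoint_left]
      intro c hc hc'
      exact hab ((mem_piAntidiag.1 hc).1.symm.trans (mem_piAntidiag.1 hc').1)
  have hinj : Set.InjOn (fun c => (restr J c, restr I c)) (T : Set (ℕ → ℕ)) := by
    intro c hc d hd hcd
    simp only [Prod.mk.injEq] at hcd
    funext j
    by_cases hjI : j ∈ I
    · simpa [restr, hjI] using congrFun hcd.2 j
    · by_cases hjN : j ∈ N
      · simpa [restr, hJ, hjI, hjN] using congrFun hcd.1 j
      · have h1 : c j = 0 := by_contra fun h => hjN (hsupp c hc j h)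
        have h2 : d j = 0 := by_contra fun h => hjN (hsupp d hd j h)
        rw [h1, h2]
  have hw : ∀ c, wt N c = wt J (restr J c) * wt I (restr I c) := by
    intro c
    rw [wt, wt, wt, ← prod_sdiff hI]
    congr 1
    · exact prod_congr rfl fun j hj => by
        simp only [restr, if_pos hj]
    · exact prod_congr rfl fun j hj => by simp only [restr, if_pos hj]
  calc ∑ c ∈ T, wt N c
      = ∑ c ∈ T, (fun p : (ℕ → ℕ) × (ℕ → ℕ) => wt J p.1 * wt I p.2)
          ((fun c => (restr J c, restr I c)) c) := sum_congr rfl fun c _ => hw c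
    _ = ∑ p ∈ T.image (fun c => (restr J c, restr I c)), wt J p.1 * wt I p.2 :=
        (sum_image (f := fun p : (ℕ → ℕ) × (ℕ → ℕ) => wt J p.1 * wt I p.2) hinj).symm
    _ ≤ ∑ p ∈ ((range (L + 1)).biUnion (fun l => piAntidiag J l)) ×ˢ piAntidiag I m,
          wt J p.1 * wt I p.2 := by
        refine sum_le_sum_of_subset_of_nonneg ?_
          fun p _ _ => mul_nonneg (wt_nonneg _ _) (wt_nonneg _ _)
        intro p hp
        obtain ⟨c, hc, rfl⟩ := mem_image.1 hp
        rw [mem_product, mem_biUnion]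
        refine ⟨⟨∑ j ∈ J, c j, ?_, ?_⟩, ?_⟩
        · rw [mem_range, Nat.lt_succ_iff]
          exact le_sup (f := fun c => ∑ j ∈ J, c j) hc
        · rw [mem_piAntidiag]
          refine ⟨sum_congr rfl fun j hj => by simp only [restr, if_pos hj], fun i hi => ?_⟩
          by_contra h
          exact hi (by simp only [restr, if_neg h])
        · rw [mem_piAntidiag]
          refine ⟨?_, fun i hi => ?_⟩
          · rw [← hm c hc]
            exact sum_congr rfl fun j hj => by simp only [restr, if_pos hj]
          · by_contra h
            exact hi (by simp only [restr, if_neg h])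
    _ = (∑ d ∈ (range (L + 1)).biUnion (fun l => piAntidiag J l), wt J d) *
          ∑ d ∈ piAntidiag I m, wt I d := by
        rw [sum_product, sum_mul_sum]
    _ ≤ _ := by
        rw [sum_wt_piAntidiag]
        refine mul_le_mul_of_nonneg_right hbU ?_
        have := Hset_nonneg I
        positivity

/-- Remove one cycle of length `j`. -/
def dec (j : ℕ) (c : ℕ → ℕ) : ℕ → ℕ := Function.update c j (c j - 1)

lemma wt_dec (N : Finset ℕ) (j : ℕ) (hj : j ∈ N) (hj0 : j ≠ 0) (c : ℕ → ℕ) (hc : c j ≠ 0) :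
    (j : ℝ) * c j * wt N c = wt N (dec j c) := by
  rw [wt, wt, ← mul_prod_erase N _ hj, ← mul_prod_erase N _ hj]
  have : ∏ i ∈ N.erase j, ((1 : ℝ) / i) ^ (dec j c i) / (dec j c i).factorial =
      ∏ i ∈ N.erase j, ((1 : ℝ) / i) ^ (c i) / (c i).factorial := by
    refine prod_congr rfl fun i hi => ?_
    rw [dec, Function.update_of_ne (ne_of_mem_erase hi)]
  rw [this, ← mul_assoc]
  congr 1
  obtain ⟨k, hk⟩ := Nat.exists_eq_succ_of_ne_zero hc
  have : dec j c j = k := by simp [dec, hk]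
  rw [this, hk, Nat.succ_eq_add_one, Nat.factorial_succ, pow_succ]
  have : (j : ℝ) ≠ 0 := by exact_mod_cast hj0
  push_cast
  field_simp

lemma sum_dec (N : Finset ℕ) (j : ℕ) (hj : j ∈ N) (c : ℕ → ℕ) (hc : c j ≠ 0) (f : ℕ → ℕ) :
    ∑ i ∈ N, f i * dec j c i + f j = ∑ i ∈ N, f i * c i := by
  rw [← add_sum_erase N _ hj, ← add_sum_erase N (fun i => f i * c i) hj]
  have : ∑ i ∈ N.erase j, f i * dec j c i = ∑ i ∈ N.erase j, f i * c i := by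
    refine sum_congr rfl fun i hi => ?_
    rw [dec, Function.update_of_ne (ne_of_mem_erase hi)]
  rw [this]
  obtain ⟨k, hk⟩ := Nat.exists_eq_succ_of_ne_zero hc
  have : dec j c j = k := by simp [dec, hk]
  simp only [this, hk, Nat.succ_eq_add_one]
  ring

lemma part_le (n : ℕ) (I : Finset ℕ) (hI : I ⊆ Icc 1 n) (K : Finset ℕ) (hK : K ⊆ Icc 1 n)
    (m' : ℕ) (S : Finset (ℕ → ℕ))
    (hsupp : ∀ c ∈ S, ∀ j, c j ≠ 0 → j ∈ Icc 1 n) (hn : ∀ c ∈ S, ∑ j ∈ Icc 1 n, j * c j = n)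
    (hm : ∀ c ∈ S, ∀ j ∈ K, c j ≠ 0 → ∑ i ∈ I, dec j c i = m') :
    ∑ j ∈ K, ∑ c ∈ S, (j : ℝ) * c j * wt (Icc 1 n) c ≤
      Real.exp (Hset (Icc 1 n) - Hset I) * (Hset I ^ m' / m'.factorial) := by
  classical
  set P := (K ×ˢ S).filter (fun p => p.2 p.1 ≠ 0) with hP
  have memP : ∀ p, p ∈ P → p.1 ∈ K ∧ p.2 ∈ S ∧ p.2 p.1 ≠ 0 := by
    intro p hp
    rw [hP, mem_filter, mem_product] at hp
    exact ⟨hp.1.1, hp.1.2, hp.2⟩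
  have hinj : Set.InjOn (fun p : ℕ × (ℕ → ℕ) => dec p.1 p.2) (P : Set (ℕ × (ℕ → ℕ))) := by
    rintro ⟨j, c⟩ hp ⟨k, d⟩ hq h
    obtain ⟨h1, h2, h3⟩ := memP _ hp
    obtain ⟨k1, k2, k3⟩ := memP _ hq
    simp only at h h1 h2 h3 k1 k2 k3
    have e1 := sum_dec (Icc 1 n) j (hK h1) c h3 (fun i => i)
    have e2 := sum_dec (Icc 1 n) k (hK k1) d k3 (fun i => i)
    rw [hn c h2, h] at e1
    rw [hn d k2] at e2
    have hjk : j = k := by omega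
    subst hjk
    congr 1
    funext i
    have hi := congrFun h i
    by_cases hij : i = j
    · subst hij
      simp only [dec, Function.update_self] at hi
      omega
    · simpa only [dec, Function.update_of_ne hij] using hi
  calc ∑ j ∈ K, ∑ c ∈ S, (j : ℝ) * c j * wt (Icc 1 n) c
      = ∑ p ∈ K ×ˢ S, (p.1 : ℝ) * (p.2 p.1 : ℕ) * wt (Icc 1 n) p.2 := by rw [sum_product]
    _ = ∑ p ∈ P, (p.1 : ℝ) * (p.2 p.1 : ℕ) * wt (Icc 1 n) p.2 := by
        rw [hP]
        refine (sum_filter_of_ne ?_).symm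
        intro p _ hne h0
        apply hne
        simp [h0]
    _ = ∑ p ∈ P, wt (Icc 1 n) (dec p.1 p.2) := by
        refine sum_congr rfl fun p hp => ?_
        obtain ⟨h1, h2, h3⟩ := memP _ hp
        have := (mem_Icc.1 (hK h1)).1
        exact wt_dec _ _ (hK h1) (by omega) _ h3
    _ = ∑ c ∈ P.image (fun p : ℕ × (ℕ → ℕ) => dec p.1 p.2), wt (Icc 1 n) c :=
        (sum_image (f := wt (Icc 1 n)) hinj).symm
    _ ≤ _ := by
        refine sum_wt_le _ _ hI _ _ ?_ ?_
        · intro c hc j hj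
          obtain ⟨p, hp, rfl⟩ := mem_image.1 hc
          obtain ⟨h1, h2, h3⟩ := memP _ hp
          apply hsupp p.2 h2
          intro h0
          apply hj
          by_cases hjp : j = p.1
          · subst hjp; simp [dec, h0]
          · simp [dec, Function.update_of_ne hjp, h0]
        · intro c hc
          obtain ⟨p, hp, rfl⟩ := mem_image.1 hc
          obtain ⟨h1, h2, h3⟩ := memP _ hp
          exact hm p.2 h2 p.1 h1 h3

lemma main_sum (n : ℕ) (I : Finset ℕ) (hne : I.Nonempty) (hI : I ⊆ Icc 1 n)
    (m : ℕ) (S : Finset (ℕ → ℕ))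
    (hsupp : ∀ c ∈ S, ∀ j, c j ≠ 0 → j ∈ Icc 1 n) (hn : ∀ c ∈ S, ∑ j ∈ Icc 1 n, j * c j = n)
    (hm : ∀ c ∈ S, ∑ i ∈ I, c i = m) :
    n * ∑ c ∈ S, wt (Icc 1 n) c ≤
      Real.exp (Hset (Icc 1 n) - Hset I) * (Hset I ^ m / m.factorial) *
        ((if I ≠ Finset.Icc 1 n then (1 : ℝ) else 0) + (m : ℝ) / Hset I) := by
  have hpos : 0 < Hset I := by
    refine sum_pos (fun j hj => ?_) hne
    have : 0 < j := (mem_Icc.1 (hI hj)).1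
    positivity
  have e : n * ∑ c ∈ S, wt (Icc 1 n) c =
      ∑ j ∈ Icc 1 n \ I, ∑ c ∈ S, (j : ℝ) * c j * wt (Icc 1 n) c +
      ∑ j ∈ I, ∑ c ∈ S, (j : ℝ) * c j * wt (Icc 1 n) c := by
    rw [sum_sdiff hI, sum_comm, mul_sum]
    refine sum_congr rfl fun c hc => ?_
    rw [← sum_mul]
    congr 1
    have := hn c hc
    exact_mod_cast this.symm
  rw [e, mul_add]
  refine add_le_add ?_ ?_
  · split_ifs with h
    · rw [mul_one]
      refine part_le n I hI _ sdiff_subset m S hsupp hn ?_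
      intro c hc j hj h0
      rw [← hm c hc]
      refine sum_congr rfl fun i hi => ?_
      rw [dec, Function.update_of_ne]
      rintro rfl
      exact (mem_sdiff.1 hj).2 hi
    · rw [not_not] at h
      simp [h]
  · rcases m with _ | m
    · have : ∑ j ∈ I, ∑ c ∈ S, (j : ℝ) * c j * wt (Icc 1 n) c = 0 := by
        refine sum_eq_zero fun j hj => sum_eq_zero fun c hc => ?_
        have := (sum_eq_zero_iff.1 (hm c hc)) j hj
        simp [this]
      rw [this]; simp
    · refine (part_le n I hI I hI m S hsupp hn ?_).trans (le_of_eq ?_)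
      · intro c hc j hj h0
        have := sum_dec I j hj c h0 (fun _ => 1)
        simp only [one_mul] at this
        rw [hm c hc] at this
        omega
      · rw [Nat.factorial_succ, pow_succ]
        push_cast
        field_simp

/-- **Local upper bound for a single set.** For nonempty `I ⊆ [n]` and `m ≥ 0`,
`P(C_I(σ) = m) ≤ (e^{H_n - H(I)}/n) (H(I)^m/m!) (1_{I ≠ [n]} + m/H(I))`;
in particular `P(C_I(σ) = 0) ≤ e^{H_n - H(I)}/n`. -/
theorem local_upper_bound_single_set (n : ℕ) (I : Finset ℕ) (hne : I.Nonempty)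
    (hsub : I ⊆ Finset.Icc 1 n) (m : ℕ) :
    permP n (fun σ => cycleCountIn σ I = m)
      ≤ Real.exp (harm n - Hset I) / n * (Hset I ^ m / m.factorial) *
          ((if I ≠ Finset.Icc 1 n then (1 : ℝ) else 0) + (m : ℝ) / Hset I) ∧
    permP n (fun σ => cycleCountIn σ I = 0)
      ≤ Real.exp (harm n - Hset I) / n := by
  classical
  have hn : 1 ≤ n := by
    obtain ⟨j, hj⟩ := hne
    have := mem_Icc.1 (hsub hj)
    omega
  have hn0 : (0 : ℝ) < n := by exact_mod_cast hn
  have key : ∀ m : ℕ, permP n (fun σ => cycleCountIn σ I = m)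
      ≤ Real.exp (harm n - Hset I) / n * (Hset I ^ m / m.factorial) *
          ((if I ≠ Finset.Icc 1 n then (1 : ℝ) else 0) + (m : ℝ) / Hset I) := by
    intro m
    set E := (Finset.univ : Finset (Equiv.Perm (Fin n))).filter
      (fun σ => cycleCountIn σ I = m) with hE
    set S := E.image (fun σ => cycleCount σ) with hS
    have hmemS : ∀ c ∈ S, ∃ σ : Equiv.Perm (Fin n), cycleCountIn σ I = m ∧ cycleCount σ = c := by
      intro c hc
      obtain ⟨σ, hσ, rfl⟩ := mem_image.1 hc
      exact ⟨σ, (mem_filter.1 hσ).2, rfl⟩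
    have h1 : permP n (fun σ => cycleCountIn σ I = m) ≤ ∑ c ∈ S, wt (Icc 1 n) c := by
      rw [permP, Nat.card_eq_fintype_card, Fintype.card_subtype, div_le_iff₀ (by positivity),
        sum_mul, card_eq_sum_card_image (fun σ => cycleCount σ)]
      push_cast
      refine sum_le_sum fun c hc => ?_
      obtain ⟨τ, _, rfl⟩ := hmemS c hc
      rw [mul_comm]
      exact card_fiber_le hn τ _ fun σ hσ => (mem_filter.1 hσ).2
    have h2 := main_sum n I hne hsub m S
      (fun c hc j hj => by
        obtain ⟨σ, _, rfl⟩ := hmemS c hc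
        exact cycleCount_ne_zero σ j hj)
      (fun c hc => by
        obtain ⟨σ, _, rfl⟩ := hmemS c hc
        exact sum_cycleCount hn σ)
      (fun c hc => by
        obtain ⟨σ, h, rfl⟩ := hmemS c hc
        exact h)
    refine h1.trans ?_
    rw [div_mul_eq_mul_div, div_mul_eq_mul_div, le_div_iff₀ hn0, mul_comm, harm]
    exact h2
  refine ⟨key m, (key 0).trans ?_⟩
  have hp : 0 ≤ Real.exp (harm n - Hset I) / n := by positivity
  simp only [pow_zero, Nat.factorial_zero, Nat.cast_one, div_one, mul_one, Nat.cast_zero,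
    zero_div, add_zero]
  split_ifs
  · rw [mul_one]
  · rw [mul_zero]; exact hp
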